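/- Let b > 0, c be constants and m ≥ 1 an integer, and let φ(s) = √(b²−s²)/b + √(b²−s²)∫₀ˢ c·t^{2m}(b²−t²)^{−3/2} dt. On U = ℝ² ∖ {0} define σ(x) = (m − ½)ln[(x¹)² + (x²)²], α = e^{σ(x)}√((y¹)²+(y²)²), and β = b·e^{σ(x)}(x²y¹ − x¹y²)/√((x¹)²+(x²)²). Then F = αφ(β/α) satisfies the Hamel equations F_{x^my^l}y^m − F_{x^l} = 0 at all (x,y) with x ∈ U, y ≠ 0 and |β(x,y)| < b·α(x,y) (hence F is projectively flat), while the 1-form β is not closed. -/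

import Mathlib

open scoped BigOperators
open Real

noncomputable section

/-- Points (and vectors) of the plane. -/
abbrev Pt : Type := Fin 2 → ℝ

/-- Partial derivative of a scalar function on `ℝ²` in the `j`-th coordinate direction. -/
def pd (f : Pt → ℝ) (j : Fin 2) (x : Pt) : ℝ := fderiv ℝ f x (Pi.single j 1)

/-- Christoffel symbols `γ^k_{ij}` of a Riemannian metric `a`. -/
def christoffel (a : Pt → Matrix (Fin 2) (Fin 2) ℝ) (k i j : Fin 2) (x : Pt) : ℝ :=
  (1/2) * ∑ l, (a x)⁻¹ k l *
    (pd (fun z => a z l j) i x + pd (fun z => a z l i) j x - pd (fun z => a z i j) l x)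

/-- Covariant derivative `c_{i|j}` of a 1-form `c` with respect to the metric `a`. -/
def covD (a : Pt → Matrix (Fin 2) (Fin 2) ℝ) (c : Pt → Fin 2 → ℝ) (i j : Fin 2) (x : Pt) : ℝ :=
  pd (fun z => c z i) j x - ∑ k, c x k * christoffel a k i j x

/-- `r_{ij}`, the symmetrized covariant derivative of the 1-form `b`. -/
def rr (a : Pt → Matrix (Fin 2) (Fin 2) ℝ) (b : Pt → Fin 2 → ℝ) (i j : Fin 2) (x : Pt) : ℝ :=
  (covD a b i j x + covD a b j i x) / 2

/-- `s_{ij}`, the antisymmetrized covariant derivative of the 1-form `b`. -/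
def so (a : Pt → Matrix (Fin 2) (Fin 2) ℝ) (b : Pt → Fin 2 → ℝ) (i j : Fin 2) (x : Pt) : ℝ :=
  (covD a b i j x - covD a b j i x) / 2

/-- `bⁱ := a^{ik} b_k`. -/
def bUp (a : Pt → Matrix (Fin 2) (Fin 2) ℝ) (b : Pt → Fin 2 → ℝ) (i : Fin 2) (x : Pt) : ℝ :=
  ∑ k, (a x)⁻¹ i k * b x k

/-- `b² := a^{ij} b_i b_j`, the squared norm of `β` with respect to `α`. -/
def bsq (a : Pt → Matrix (Fin 2) (Fin 2) ℝ) (b : Pt → Fin 2 → ℝ) (x : Pt) : ℝ :=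
  ∑ i, bUp a b i x * b x i

/-- `s_j := bⁱ s_{ij}`. -/
def sLow (a : Pt → Matrix (Fin 2) (Fin 2) ℝ) (b : Pt → Fin 2 → ℝ) (j : Fin 2) (x : Pt) : ℝ :=
  ∑ i, bUp a b i x * so a b i j x

/-- `sⁱ := a^{ik} s_k`. -/
def sUp (a : Pt → Matrix (Fin 2) (Fin 2) ℝ) (b : Pt → Fin 2 → ℝ) (i : Fin 2) (x : Pt) : ℝ :=
  ∑ k, (a x)⁻¹ i k * sLow a b k x

/-- `s₀ := s_j y^j`. -/
def sZero (a : Pt → Matrix (Fin 2) (Fin 2) ℝ) (b : Pt → Fin 2 → ℝ) (x : Pt) (y : Fin 2 → ℝ) : ℝ :=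
  ∑ j, sLow a b j x * y j

/-- The Riemannian norm `α(x,y) = √(a_{ij} yⁱ yʲ)`. -/
def alphaF (a : Pt → Matrix (Fin 2) (Fin 2) ℝ) (x : Pt) (y : Fin 2 → ℝ) : ℝ :=
  Real.sqrt (∑ i, ∑ j, a x i j * y i * y j)

/-- The 1-form `β(x,y) = b_i(x) yⁱ`. -/
def betaF (b : Pt → Fin 2 → ℝ) (x : Pt) (y : Fin 2 → ℝ) : ℝ := ∑ i, b x i * y i

/-- Fundamental tensor `g_{ij} := ½ [F²]_{yⁱyʲ}` of a Finsler metric `F`. -/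
def gMat (F : Pt → (Fin 2 → ℝ) → ℝ) (x : Pt) (y : Fin 2 → ℝ) : Matrix (Fin 2) (Fin 2) ℝ :=
  Matrix.of fun i j =>
    (1/2) * fderiv ℝ (fun y1 => fderiv ℝ (fun y2 => (F x y2)^2) y1 (Pi.single j 1)) y
      (Pi.single i 1)

/-- Spray coefficients `Gⁱ := ¼ g^{il} ([F²]_{x^k y^l} y^k − [F²]_{x^l})` of a Finsler metric. -/
def spray (F : Pt → (Fin 2 → ℝ) → ℝ) (i : Fin 2) (x : Pt) (y : Fin 2 → ℝ) : ℝ :=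
  (1/4) * ∑ l, (gMat F x y)⁻¹ i l *
    ((∑ k, (fderiv ℝ (fun x' => fderiv ℝ (fun y' => (F x' y')^2) y (Pi.single l 1)) x
        (Pi.single k 1)) * y k)
      - fderiv ℝ (fun x' => (F x' y)^2) x (Pi.single l 1))

/-- `F` is a Douglas metric on `U`: for each `x ∈ U`, `G¹y² − G²y¹` is a homogeneous
polynomial of degree 3 in `(y¹, y²)`. -/
def IsDouglasOn (F : Pt → (Fin 2 → ℝ) → ℝ) (U : Set Pt) : Prop :=
  ∀ x ∈ U, ∃ c0 c1 c2 c3 : ℝ, ∀ y : Fin 2 → ℝ, y ≠ 0 →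
    spray F 0 x y * y 1 - spray F 1 x y * y 0 =
      c0 * (y 0)^3 + c1 * (y 0)^2 * y 1 + c2 * (y 0) * (y 1)^2 + c3 * (y 1)^3

/-- The Hamel operator `F_{x^m y^l} y^m − F_{x^l}`. -/
def Hamel (F : Pt → (Fin 2 → ℝ) → ℝ) (x : Pt) (y : Fin 2 → ℝ) (l : Fin 2) : ℝ :=
  (∑ m, fderiv ℝ (fun x' => fderiv ℝ (fun y' => F x' y') y (Pi.single l 1)) x
      (Pi.single m 1) * y m)
    - fderiv ℝ (fun x' => F x' y) x (Pi.single l 1)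

/-- `F` is projectively flat on `U` (Hamel equations). -/
def ProjFlatOn (F : Pt → (Fin 2 → ℝ) → ℝ) (U : Set Pt) : Prop :=
  ∀ x ∈ U, ∀ y : Fin 2 → ℝ, y ≠ 0 → ∀ l, Hamel F x y l = 0

/-- Spray coefficients `G^i_α := ½ γ^i_{jk} y^j y^k` of the Riemannian metric `α`. -/
def sprayA (a : Pt → Matrix (Fin 2) (Fin 2) ℝ) (i : Fin 2) (x : Pt) (y : Fin 2 → ℝ) : ℝ :=
  (1/2) * ∑ j, ∑ k, christoffel a i j k x * y j * y k

/-- The projective factor `P = F_{x^m} y^m / (2F)`. -/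
def projFac (F : Pt → (Fin 2 → ℝ) → ℝ) (x : Pt) (y : Fin 2 → ℝ) : ℝ :=
  (∑ m, fderiv ℝ (fun x' => F x' y) x (Pi.single m 1) * y m) / (2 * F x y)

/-- Pullback of a Finsler metric under a coordinate map `ψ`. -/
def pullF (F : Pt → (Fin 2 → ℝ) → ℝ) (ψ : Pt → Pt) : Pt → (Fin 2 → ℝ) → ℝ :=
  fun z y => F (ψ z) (fderiv ℝ ψ z y)

/-- `ψ` is a (curvilinear) coordinate chart: a smooth injective map from the open set `V`
into `U` with everywhere invertible differential. -/
def IsCoordChart (ψ : Pt → Pt) (V U : Set Pt) : Prop :=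
  IsOpen V ∧ ContDiffOn ℝ (⊤ : ℕ∞) ψ V ∧ Set.InjOn ψ V ∧ ψ '' V ⊆ U ∧
    ∀ z ∈ V, LinearMap.det ((fderiv ℝ ψ z) : Pt →ₗ[ℝ] Pt) ≠ 0

/-- `F` is locally projectively flat on `U`: around every point there are local coordinates
in which `F` satisfies the Hamel equations. -/
def IsLocProjFlatOn (F : Pt → (Fin 2 → ℝ) → ℝ) (U : Set Pt) : Prop :=
  ∀ x ∈ U, ∃ (V : Set Pt) (ψ : Pt → Pt), IsCoordChart ψ V U ∧ x ∈ ψ '' V ∧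
    ProjFlatOn (pullF F ψ) V


lemma exp_half_log (k : ℕ) {R : ℝ} (hR : 0 < R) :
    Real.exp ((((k + 1 : ℕ) : ℝ) - 1/2) * Real.log R) = R ^ k * Real.sqrt R := by
  rw [Real.sqrt_eq_rpow, ← Real.rpow_natCast R k, ← Real.rpow_add hR, Real.rpow_def_of_pos hR]
  congr 1
  push_cast
  ring

/-- The Hamel operator only depends on the germ of the Finsler function. -/
lemma Hamel_congr {F G : Pt → Pt → ℝ} {Ω : Set (Pt × Pt)} (hΩ : IsOpen Ω)
    (h : ∀ q ∈ Ω, F q.1 q.2 = G q.1 q.2) {x y : Pt} (hxy : (x, y) ∈ Ω) (l : Fin 2) :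
    Hamel F x y l = Hamel G x y l := by
  have hx : ∀ᶠ x' in nhds x, (x', y) ∈ Ω :=
    (Continuous.prodMk_left y).continuousAt.eventually (hΩ.mem_nhds hxy)
  have e₁ : (fun x' => fderiv ℝ (fun y' => F x' y') y (Pi.single l 1)) =ᶠ[nhds x]
      (fun x' => fderiv ℝ (fun y' => G x' y') y (Pi.single l 1)) := by
    filter_upwards [hx] with x' hx'
    have hy : ∀ᶠ y' in nhds y, (x', y') ∈ Ω :=
      (Continuous.prodMk_right x').continuousAt.eventually (hΩ.mem_nhds hx')
    have : (fun y' => F x' y') =ᶠ[nhds y] (fun y' => G x' y') := by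
      filter_upwards [hy] with y' hy' using h _ hy'
    rw [this.fderiv_eq]
  have e₂ : (fun x' => F x' y) =ᶠ[nhds x] (fun x' => G x' y) := by
    filter_upwards [hx] with x' hx' using h _ hx'
  unfold Hamel
  rw [e₁.fderiv_eq, e₂.fderiv_eq]

/-- `R ^ k * p * Ψ (w / p)` with `R = |x|²`, `p = x · y` and `w = x² y¹ - x¹ y²`. -/
def radialF (k : ℕ) (Ψ : ℝ → ℝ) (x y : Pt) : ℝ :=
  (x 0 ^ 2 + x 1 ^ 2) ^ k * (x 0 * y 0 + x 1 * y 1) *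
    Ψ ((x 1 * y 0 - x 0 * y 1) / (x 0 * y 0 + x 1 * y 1))

lemma hasFDerivAt_coord (i : Fin 2) (x : Pt) :
    HasFDerivAt (fun z : Pt => z i) (ContinuousLinearMap.proj (R := ℝ) i) x :=
  (ContinuousLinearMap.proj (R := ℝ) (φ := fun _ : Fin 2 => ℝ) i).hasFDerivAt

/-- `Ψ` is a primitive of `v ↦ K * (v² / (1 + v²)) ^ (k + 1)`. -/
def IsAngularProfile (K : ℝ) (k : ℕ) (Ψ : ℝ → ℝ) : Prop :=
  ∀ v, HasDerivAt Ψ (K * (v ^ 2 / (1 + v ^ 2)) ^ (k + 1)) v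

lemma angular_weight (k : ℕ) {x y : Pt} (hp : x 0 * y 0 + x 1 * y 1 ≠ 0) :
    (((x 1 * y 0 - x 0 * y 1) / (x 0 * y 0 + x 1 * y 1)) ^ 2 /
      (1 + ((x 1 * y 0 - x 0 * y 1) / (x 0 * y 0 + x 1 * y 1)) ^ 2)) ^ (k + 1) =
    (x 1 * y 0 - x 0 * y 1) ^ (2 * (k + 1)) /
      ((x 0 ^ 2 + x 1 ^ 2) ^ (k + 1) * (y 0 ^ 2 + y 1 ^ 2) ^ (k + 1)) := by
  have h1 : 0 < (x 0 * y 0 + x 1 * y 1) ^ 2 := by positivity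
  have h2 : (x 0 ^ 2 + x 1 ^ 2) * (y 0 ^ 2 + y 1 ^ 2) =
    (x 0 * y 0 + x 1 * y 1) ^ 2 + (x 1 * y 0 - x 0 * y 1) ^ 2 := by ring
  rw [pow_mul, ← mul_pow, ← div_pow, h2]
  congr 1
  have := sq_nonneg (x 1 * y 0 - x 0 * y 1)
  have h3 : (x 0 * y 0 + x 1 * y 1) ^ 2 + (x 1 * y 0 - x 0 * y 1) ^ 2 ≠ 0 := by positivity
  generalize x 0 * y 0 + x 1 * y 1 = p at *
  generalize x 1 * y 0 - x 0 * y 1 = w at *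
  field_simp

lemma sq_pos_of_pairing {x y : Pt} (hp : x 0 * y 0 + x 1 * y 1 ≠ 0) :
    0 < x 0 ^ 2 + x 1 ^ 2 ∧ 0 < y 0 ^ 2 + y 1 ^ 2 := by
  have h1 : 0 < (x 0 * y 0 + x 1 * y 1) ^ 2 := by positivity
  have h2 : (x 0 ^ 2 + x 1 ^ 2) * (y 0 ^ 2 + y 1 ^ 2) =
    (x 0 * y 0 + x 1 * y 1) ^ 2 + (x 1 * y 0 - x 0 * y 1) ^ 2 := by ring
  have h3 : 0 < (x 0 ^ 2 + x 1 ^ 2) * (y 0 ^ 2 + y 1 ^ 2) := by rw [h2]; positivity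
  constructor
  · exact pos_of_mul_pos_left h3 (by positivity)
  · exact pos_of_mul_pos_right h3 (by positivity)

lemma fderiv_radialF_snd {K : ℝ} {k : ℕ} {Ψ : ℝ → ℝ} (hΨ : IsAngularProfile K k Ψ) {x y : Pt}
    (hp : x 0 * y 0 + x 1 * y 1 ≠ 0) (v : Pt) :
    fderiv ℝ (fun y' => radialF k Ψ x y') y v =
      (x 0 ^ 2 + x 1 ^ 2) ^ k * (x 0 * v 0 + x 1 * v 1) *
        Ψ ((x 1 * y 0 - x 0 * y 1) / (x 0 * y 0 + x 1 * y 1)) +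
      K * (v 0 * y 1 - v 1 * y 0) * (x 1 * y 0 - x 0 * y 1) ^ (2 * (k + 1)) /
        ((x 0 * y 0 + x 1 * y 1) * (y 0 ^ 2 + y 1 ^ 2) ^ (k + 1)) := by
  obtain ⟨hR, hY⟩ := sq_pos_of_pairing hp
  have d0 := hasFDerivAt_coord 0 y
  have d1 := hasFDerivAt_coord 1 y
  have dp := (d0.const_mul (x 0)).add (d1.const_mul (x 1))
  have dw := (d0.const_mul (x 1)).sub (d1.const_mul (x 0))
  have dq := dw.mul ((hasDerivAt_inv hp).comp_hasFDerivAt y dp)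
  have dΨ := (hΨ ((x 1 * y 0 - x 0 * y 1) / (x 0 * y 0 + x 1 * y 1))).comp_hasFDerivAt y dq
  have dF : HasFDerivAt (radialF k Ψ x) _ y :=
    (dp.const_mul ((x 0 ^ 2 + x 1 ^ 2) ^ k)).mul dΨ
  rw [angular_weight k hp] at dF
  rw [dF.fderiv]
  simp
  generalize Ψ _ = P
  field_simp
  ring

lemma exists_hasFDerivAt_angular {K : ℝ} {k : ℕ} {Ψ : ℝ → ℝ} (hΨ : IsAngularProfile K k Ψ) {x y : Pt}
    (hp : x 0 * y 0 + x 1 * y 1 ≠ 0) :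
    ∃ L : Pt →L[ℝ] ℝ, HasFDerivAt
      (fun x' : Pt => Ψ ((x' 1 * y 0 - x' 0 * y 1) / (x' 0 * y 0 + x' 1 * y 1))) L x ∧
      ∀ u, L u = K * (x 1 * y 0 - x 0 * y 1) ^ (2 * (k + 1)) * (x 0 * u 1 - x 1 * u 0) /
        ((x 0 ^ 2 + x 1 ^ 2) ^ (k + 1) * (y 0 ^ 2 + y 1 ^ 2) ^ k *
          (x 0 * y 0 + x 1 * y 1) ^ 2) := by
  obtain ⟨hR, hY⟩ := sq_pos_of_pairing hp
  have d0 := hasFDerivAt_coord 0 x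
  have d1 := hasFDerivAt_coord 1 x
  have dp := (d0.mul_const (y 0)).add (d1.mul_const (y 1))
  have dw := (d1.mul_const (y 0)).sub (d0.mul_const (y 1))
  have dq := dw.mul ((hasDerivAt_inv hp).comp_hasFDerivAt x dp)
  have dΨ := (hΨ ((x 1 * y 0 - x 0 * y 1) / (x 0 * y 0 + x 1 * y 1))).comp_hasFDerivAt x dq
  refine ⟨_, dΨ, fun u => ?_⟩
  rw [angular_weight k hp]
  simp
  field_simp
  ring

lemma Hamel_radialF {K : ℝ} {k : ℕ} {Ψ : ℝ → ℝ} (hΨ : IsAngularProfile K k Ψ) {x y : Pt}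
    (hp : x 0 * y 0 + x 1 * y 1 ≠ 0) (l : Fin 2) : Hamel (radialF k Ψ) x y l = 0 := by
  obtain ⟨hR, hY⟩ := sq_pos_of_pairing hp
  obtain ⟨L, hL, hLu⟩ := exists_hasFDerivAt_angular hΨ hp
  have d0 := hasFDerivAt_coord 0 x
  have d1 := hasFDerivAt_coord 1 x
  have dR := ((d0.pow 2).add (d1.pow 2)).pow k
  have dp := (d0.mul_const (y 0)).add (d1.mul_const (y 1))
  have dw := (d1.mul_const (y 0)).sub (d0.mul_const (y 1))
  have dF : HasFDerivAt (fun x' => radialF k Ψ x' y) _ x := (dR.mul dp).mul hL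
  obtain ⟨v, hv⟩ : ∃ v : Pt, v = Pi.single l 1 := ⟨_, rfl⟩
  have hopen : ∀ᶠ x' : Pt in nhds x, x' 0 * y 0 + x' 1 * y 1 ≠ 0 :=
    (by fun_prop : Continuous fun x' : Pt => x' 0 * y 0 + x' 1 * y 1).continuousAt.eventually_ne hp
  have e : (fun x' => fderiv ℝ (fun y' => radialF k Ψ x' y') y v) =ᶠ[nhds x] _ :=
    hopen.mono fun x' hx' => fderiv_radialF_snd hΨ hx' v
  have dv := (d0.mul_const (v 0)).add (d1.mul_const (v 1))
  have dB := ((dw.pow (2 * (k + 1))).const_mul (K * (v 0 * y 1 - v 1 * y 0))).mul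
    ((hasDerivAt_inv (mul_ne_zero hp (pow_pos hY (k + 1)).ne')).comp_hasFDerivAt x
      (dp.mul_const ((y 0 ^ 2 + y 1 ^ 2) ^ (k + 1))))
  have dA := ((dR.mul dv).mul hL).add dB
  have hsum : ∀ M : Pt →L[ℝ] ℝ, ∑ i, M (Pi.single i 1) * y i = M y := by
    intro M
    conv_rhs => rw [pi_eq_sum_univ' y, map_sum]
    refine Finset.sum_congr rfl fun i _ => ?_
    rw [map_smul, smul_eq_mul, mul_comm]
  unfold Hamel
  rw [hsum, ← hv, e.fderiv_eq, dF.fderiv]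
  refine (congrArg (fun M : Pt →L[ℝ] ℝ => M y - _) (HasFDerivAt.fderiv dA)).trans ?_
  simp [hLu]
  have hA : (x 0 ^ 2 + x 1 ^ 2) ^ k ≠ 0 := by positivity
  have hB : (y 0 ^ 2 + y 1 ^ 2) ^ k ≠ 0 := by positivity
  have hR' := hR.ne'
  have hY' := hY.ne'
  rw [pow_succ _ k, pow_succ _ k]
  generalize Ψ _ = P
  generalize (x 1 * y 0 - x 0 * y 1) ^ (2 * (k + 1)) = W
  generalize (x 0 ^ 2 + x 1 ^ 2) ^ k = A at *
  generalize (y 0 ^ 2 + y 1 ^ 2) ^ k = B at *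
  generalize (x 0 ^ 2 + x 1 ^ 2) ^ (k - 1) = A'
  field_simp
  ring

/-- The integral in the metric, in terms of the tangent variable `v = s / √(b² - s²)`. -/
def tangentIntegral (b c : ℝ) (m : ℕ) (v : ℝ) : ℝ :=
  ∫ t in (0:ℝ)..(b * v / √(1 + v ^ 2)), c * t ^ (2 * m) * ((b ^ 2 - t ^ 2) ^ (-(3:ℝ)/2))

lemma sq_mul_div_sqrt (b v : ℝ) :
    b ^ 2 - (b * v / √(1 + v ^ 2)) ^ 2 = b ^ 2 / (1 + v ^ 2) := by
  have h : 0 < 1 + v ^ 2 := by positivity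
  rw [div_pow, Real.sq_sqrt h.le]
  field_simp
  ring

lemma hasDerivAt_mul_div_sqrt (b v : ℝ) :
    HasDerivAt (fun v : ℝ => b * v / √(1 + v ^ 2)) (b / ((1 + v ^ 2) * √(1 + v ^ 2))) v := by
  have h : 0 < 1 + v ^ 2 := by positivity
  have hs : √(1 + v ^ 2) ≠ 0 := (Real.sqrt_pos.2 h).ne'
  have h2 := Real.sq_sqrt h.le
  have d1 : HasDerivAt (fun v : ℝ => 1 + v ^ 2) (2 * v) v := by
    simpa using (hasDerivAt_pow 2 v).const_add 1
  have d2 := ((hasDerivAt_id v).const_mul b).div (d1.sqrt h.ne') hs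
  refine d2.congr_deriv ?_
  simp only [id]
  field_simp
  rw [h2]
  ring

lemma hasDerivAt_tangentIntegral {b : ℝ} (hb : 0 < b) (c : ℝ) (k : ℕ) (v : ℝ) :
    HasDerivAt (tangentIntegral b c (k + 1))
      (c * b ^ (2 * k) * (v ^ 2 / (1 + v ^ 2)) ^ (k + 1)) v := by
  set s := b * v / √(1 + v ^ 2) with hs
  set f : ℝ → ℝ := fun t => c * t ^ (2 * (k + 1)) * ((b ^ 2 - t ^ 2) ^ (-(3:ℝ)/2)) with hf
  have h : 0 < 1 + v ^ 2 := by positivity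
  have hq : 0 < √(1 + v ^ 2) := Real.sqrt_pos.2 h
  have hbs : b ^ 2 - s ^ 2 = b ^ 2 / (1 + v ^ 2) := sq_mul_div_sqrt b v
  have hsI : s ∈ Set.Ioo (-b) b := by
    rw [Set.mem_Ioo, ← abs_lt]
    refine abs_lt_of_sq_lt_sq ?_ hb.le
    have : 0 < b ^ 2 / (1 + v ^ 2) := by positivity
    linarith
  have hcont : ContinuousOn f (Set.Ioo (-b) b) := by
    refine ContinuousOn.mul (by fun_prop) (ContinuousOn.rpow_const (by fun_prop) fun t ht => ?_)
    left
    have : t ^ 2 < b ^ 2 := sq_lt_sq' ht.1 ht.2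
    linarith
  have hsub : Set.uIcc 0 s ⊆ Set.Ioo (-b) b :=
    Set.OrdConnected.uIcc_subset Set.ordConnected_Ioo ⟨by linarith, hb⟩ hsI
  have dI : HasDerivAt (fun u => ∫ t in (0:ℝ)..u, f t) (f s) s :=
    intervalIntegral.integral_hasDerivAt_right (hcont.mono hsub).intervalIntegrable
      (hcont.stronglyMeasurableAtFilter isOpen_Ioo s hsI)
      (hcont.continuousAt (isOpen_Ioo.mem_nhds hsI))
  have d := HasDerivAt.comp v dI (hasDerivAt_mul_div_sqrt b v)
  refine HasDerivAt.congr_deriv (f := tangentIntegral b c (k + 1)) d ?_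
  have hpow : (b ^ 2 - s ^ 2) ^ (-(3:ℝ)/2) = ((1 + v ^ 2) * √(1 + v ^ 2)) / b ^ 3 := by
    have e1 : b ^ 2 - s ^ 2 = (b / √(1 + v ^ 2)) ^ (2:ℝ) := by
      rw [hbs, Real.rpow_two, div_pow, Real.sq_sqrt h.le]
    rw [e1, ← Real.rpow_mul (by positivity), show (2:ℝ) * (-3/2) = -((3:ℕ):ℝ) by norm_num,
      Real.rpow_neg (by positivity), Real.rpow_natCast, div_pow, inv_div]
    congr 1
    rw [pow_succ, Real.sq_sqrt h.le]
  have hs2 : s ^ (2 * (k + 1)) = b ^ (2 * k) * b ^ 2 * (v ^ 2 / (1 + v ^ 2)) ^ (k + 1) := by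
    rw [pow_mul, hs, div_pow, Real.sq_sqrt h.le, mul_pow, mul_div_assoc, mul_pow, ← pow_mul]
    ring
  simp only [hf]
  rw [hpow, hs2]
  generalize (v ^ 2 / (1 + v ^ 2)) ^ (k + 1) = Q
  field_simp

lemma isAngularProfile_tangentIntegral {b : ℝ} (hb : 0 < b) (c : ℝ) (k : ℕ) {ε : ℝ}
    (hε : ε ^ 2 = 1) :
    IsAngularProfile (b * (c * b ^ (2 * k))) k
      (fun t => ε * (1 + b * tangentIntegral b c (k + 1) (ε * t))) := by
  intro v
  have d := (((hasDerivAt_tangentIntegral hb c k (ε * v)).comp v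
    ((hasDerivAt_id v).const_mul ε)).const_mul b).const_add 1 |>.const_mul ε
  refine d.congr_deriv ?_
  rw [mul_pow, hε, one_mul]
  linear_combination (b * (c * b ^ (2 * k)) * (v ^ 2 / (1 + v ^ 2)) ^ (k + 1)) * hε

/-- The `(α,β)`-metric coincides with `radialF` where `x · y` has the sign `ε`. -/
lemma metric_eq_radialF {b : ℝ} (hb : 0 < b) (c : ℝ) (k : ℕ) {ε : ℝ} (hε : ε ^ 2 = 1)
    {x y : Pt} (hp : 0 < ε * (x 0 * y 0 + x 1 * y 1)) :
    (Real.exp ((((k + 1 : ℕ) : ℝ) - 1/2) * Real.log ((x 0)^2 + (x 1)^2)) *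
        Real.sqrt ((y 0)^2 + (y 1)^2)) *
      (fun s => Real.sqrt (b^2 - s^2) / b + Real.sqrt (b^2 - s^2) *
          ∫ t in (0:ℝ)..s, c * t^(2*(k + 1)) * ((b^2 - t^2) ^ (-(3:ℝ)/2)))
        ((Real.exp ((((k + 1 : ℕ) : ℝ) - 1/2) * Real.log ((x 0)^2 + (x 1)^2)) * b *
            (x 1 * y 0 - x 0 * y 1) / Real.sqrt ((x 0)^2 + (x 1)^2)) /
          (Real.exp ((((k + 1 : ℕ) : ℝ) - 1/2) * Real.log ((x 0)^2 + (x 1)^2)) *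
            Real.sqrt ((y 0)^2 + (y 1)^2))) =
    radialF k (fun t => ε * (1 + b * tangentIntegral b c (k + 1) (ε * t))) x y := by
  have hp0 : x 0 * y 0 + x 1 * y 1 ≠ 0 := right_ne_zero_of_mul hp.ne'
  obtain ⟨hR, hY⟩ := sq_pos_of_pairing hp0
  have hlag : (x 0 ^ 2 + x 1 ^ 2) * (y 0 ^ 2 + y 1 ^ 2) =
    (x 0 * y 0 + x 1 * y 1) ^ 2 + (x 1 * y 0 - x 0 * y 1) ^ 2 := by ring
  unfold radialF
  rw [exp_half_log k hR]
  generalize x 0 * y 0 + x 1 * y 1 = p at *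
  generalize x 1 * y 0 - x 0 * y 1 = w at *
  generalize x 0 ^ 2 + x 1 ^ 2 = R at *
  generalize y 0 ^ 2 + y 1 ^ 2 = Y at *
  have hr : 0 < √R := Real.sqrt_pos.2 hR
  have hy : 0 < √Y := Real.sqrt_pos.2 hY
  have hA : 0 < R ^ k := pow_pos hR k
  have hsq : 1 + (ε * (w / p)) ^ 2 = (√R * √Y / (ε * p)) ^ 2 := by
    rw [div_pow, mul_pow, mul_pow, mul_pow, Real.sq_sqrt hR.le, Real.sq_sqrt hY.le, hε, hlag]
    field_simp
  have hsqrt : √(1 + (ε * (w / p)) ^ 2) = √R * √Y / (ε * p) := by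
    rw [hsq, Real.sqrt_sq (by positivity)]
  have hs : R ^ k * √R * b * w / √R / (R ^ k * √R * √Y) =
      b * (ε * (w / p)) / √(1 + (ε * (w / p)) ^ 2) := by
    rw [hsqrt]
    field_simp
    rw [hε, mul_one]
  rw [hs]
  beta_reduce
  rw [sq_mul_div_sqrt, Real.sqrt_div (sq_nonneg b), Real.sqrt_sq hb.le]
  change _ * (_ + _ * tangentIntegral b c (k + 1) (ε * (w / p))) = _
  rw [hsqrt]
  field_simp

lemma pairing_ne_zero {b E : ℝ} (hE : 0 < E) (hb : 0 < b) {x y : Pt} (hx : x ≠ 0)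
    (h : |E * b * (x 1 * y 0 - x 0 * y 1) / √(x 0 ^ 2 + x 1 ^ 2)| <
      b * (E * √(y 0 ^ 2 + y 1 ^ 2))) :
    x 0 * y 0 + x 1 * y 1 ≠ 0 := by
  intro hp
  have hR : 0 < x 0 ^ 2 + x 1 ^ 2 := by
    refine lt_of_le_of_ne (by positivity) fun h0 => hx ?_
    have h0' : x 0 = 0 ∧ x 1 = 0 := by constructor <;> nlinarith [sq_nonneg (x 0), sq_nonneg (x 1)]
    ext i
    fin_cases i
    exacts [h0'.1, h0'.2]
  have hw : |x 1 * y 0 - x 0 * y 1| = √(x 0 ^ 2 + x 1 ^ 2) * √(y 0 ^ 2 + y 1 ^ 2) := by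
    rw [← Real.sqrt_mul hR.le, ← Real.sqrt_sq_eq_abs]
    congr 1
    linear_combination -(x 0 * y 0 + x 1 * y 1) * hp
  have hr : 0 < √(x 0 ^ 2 + x 1 ^ 2) := Real.sqrt_pos.2 hR
  rw [abs_div, abs_mul, abs_of_pos (mul_pos hE hb), abs_of_pos hr, hw] at h
  refine h.ne ?_
  field_simp

lemma not_closed {b : ℝ} (hb : 0 < b) (k : ℕ) :
    ¬ (∀ x : Pt, x ≠ 0 →
      pd (fun z => Real.exp ((((k + 1 : ℕ):ℝ) - 1/2) * Real.log ((z 0)^2 + (z 1)^2)) * b *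
          z 1 / Real.sqrt ((z 0)^2 + (z 1)^2)) 1 x =
      pd (fun z => -(Real.exp ((((k + 1 : ℕ):ℝ) - 1/2) * Real.log ((z 0)^2 + (z 1)^2)) * b *
          z 0 / Real.sqrt ((z 0)^2 + (z 1)^2))) 0 x) := by
  intro H
  have hx : (Pi.single 0 1 : Pt) ≠ 0 := by simp
  have hH := H _ hx
  have hpos : ∀ᶠ z : Pt in nhds (Pi.single 0 1), 0 < z 0 ^ 2 + z 1 ^ 2 :=
    (by fun_prop : Continuous fun z : Pt => z 0 ^ 2 + z 1 ^ 2).continuousAt.eventually_const_lt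
      (by simp)
  have e : ∀ i : Fin 2,
      (fun z : Pt => Real.exp ((((k + 1 : ℕ):ℝ) - 1/2) * Real.log ((z 0)^2 + (z 1)^2)) * b *
        z i / Real.sqrt ((z 0)^2 + (z 1)^2)) =ᶠ[nhds (Pi.single 0 1)]
      (fun z : Pt => (z 0 ^ 2 + z 1 ^ 2) ^ k * (b * z i)) := by
    intro i
    filter_upwards [hpos] with z hz
    rw [exp_half_log k hz]
    have := (Real.sqrt_pos.2 hz).ne'
    field_simp
  have d0 := hasFDerivAt_coord 0 (Pi.single 0 1)
  have d1 := hasFDerivAt_coord 1 (Pi.single 0 1)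
  have dR := ((d0.pow 2).add (d1.pow 2)).pow k
  have f1 := HasFDerivAt.fderiv ((dR.mul (d1.const_mul b)).congr_of_eventuallyEq (e 1))
  have f0 := HasFDerivAt.fderiv ((dR.mul (d0.const_mul b)).congr_of_eventuallyEq (e 0)).neg
  unfold pd at hH
  have hH' := (congrArg (fun M : Pt →L[ℝ] ℝ => M (Pi.single 1 1)) f1).symm.trans
    (hH.trans (congrArg (fun M : Pt →L[ℝ] ℝ => M (Pi.single 0 1)) f0))
  simp at hH'
  have : 0 ≤ b * (k * 2) := by positivity
  nlinarith

/-- Example 6.3 of the paper: a projectively flat singular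
(α,β)-metric with β not closed. -/
theorem stmt12 (bc c : ℝ) (hbc : 0 < bc) (m : ℕ) (hm : 1 ≤ m) :
    (∀ x : Pt, x ≠ 0 → ∀ y : Fin 2 → ℝ, y ≠ 0 →
      |Real.exp (((m:ℝ) - 1/2) * Real.log ((x 0)^2 + (x 1)^2)) * bc *
          (x 1 * y 0 - x 0 * y 1) / Real.sqrt ((x 0)^2 + (x 1)^2)| <
        bc * (Real.exp (((m:ℝ) - 1/2) * Real.log ((x 0)^2 + (x 1)^2)) *
          Real.sqrt ((y 0)^2 + (y 1)^2)) →
      ∀ l : Fin 2,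
        Hamel (fun x y =>
          (Real.exp (((m:ℝ) - 1/2) * Real.log ((x 0)^2 + (x 1)^2)) *
              Real.sqrt ((y 0)^2 + (y 1)^2)) *
            (fun s => Real.sqrt (bc^2 - s^2) / bc + Real.sqrt (bc^2 - s^2) *
                ∫ t in (0:ℝ)..s, c * t^(2*m) * ((bc^2 - t^2) ^ (-(3:ℝ)/2)))
              ((Real.exp (((m:ℝ) - 1/2) * Real.log ((x 0)^2 + (x 1)^2)) * bc *
                  (x 1 * y 0 - x 0 * y 1) / Real.sqrt ((x 0)^2 + (x 1)^2)) /
                (Real.exp (((m:ℝ) - 1/2) * Real.log ((x 0)^2 + (x 1)^2)) *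
                  Real.sqrt ((y 0)^2 + (y 1)^2))))
          x y l = 0) ∧
    ¬ (∀ x : Pt, x ≠ 0 →
      pd (fun z => Real.exp (((m:ℝ) - 1/2) * Real.log ((z 0)^2 + (z 1)^2)) * bc *
          z 1 / Real.sqrt ((z 0)^2 + (z 1)^2)) 1 x =
      pd (fun z => -(Real.exp (((m:ℝ) - 1/2) * Real.log ((z 0)^2 + (z 1)^2)) * bc *
          z 0 / Real.sqrt ((z 0)^2 + (z 1)^2))) 0 x) := by
  obtain ⟨k, rfl⟩ : ∃ k, m = k + 1 := ⟨m - 1, by omega⟩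
  refine ⟨fun x hx y _ h l => ?_, not_closed hbc k⟩
  have hp := pairing_ne_zero (Real.exp_pos _) hbc hx h
  obtain ⟨ε, hε, hpos⟩ : ∃ ε : ℝ, ε ^ 2 = 1 ∧ 0 < ε * (x 0 * y 0 + x 1 * y 1) := by
    rcases hp.lt_or_gt with h | h
    · exact ⟨-1, by norm_num, by linarith⟩
    · exact ⟨1, by norm_num, by linarith⟩
  have hΩ : IsOpen {q : Pt × Pt | 0 < ε * (q.1 0 * q.2 0 + q.1 1 * q.2 1)} :=
    isOpen_lt continuous_const (by fun_prop)
  rw [Hamel_congr hΩ (fun q hq => metric_eq_radialF hbc c k hε hq) hpos l]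
  exact Hamel_radialF (isAngularProfile_tangentIntegral hbc c k hε) hp l

end
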